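/- For every t > 0, the derivative of the Lyapunov function satisfies d/dt L(t) = 2 ∫_{β(t)−η}^{β(t)} ( v'(R(t,x)) / η ) ρ(t,x) ( V(t,x) − v̄ )² dx. -/

import Mathlib

open MeasureTheory intervalIntegral Set

/-- Differentiation under an interval integral whose integrand has a jointly continuous
derivative in the parameter. -/
theorem hasDerivAt_intervalIntegral_of_continuousOn {a b : ℝ} {U : Set ℝ} (hU : IsOpen U)
    {F F' : ℝ → ℝ → ℝ} {t : ℝ} (ht : t ∈ U)
    (hF : ∀ s ∈ U, ContinuousOn (F s) (uIcc a b))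
    (hF' : ContinuousOn (fun p : ℝ × ℝ => F' p.1 p.2) (U ×ˢ uIcc a b))
    (hd : ∀ s ∈ U, ∀ x ∈ uIcc a b, HasDerivAt (fun r => F r x) (F' s x) s) :
    HasDerivAt (fun s => ∫ x in a..b, F s x) (∫ x in a..b, F' t x) t := by
  obtain ⟨ε, hε, hεU⟩ := Metric.nhds_basis_closedBall.mem_iff.1 (hU.mem_nhds ht)
  obtain ⟨C, hC⟩ := ((isCompact_closedBall t ε).prod isCompact_uIcc).exists_bound_of_continuousOn
    (hF'.mono (Set.prod_mono hεU (Subset.refl (uIcc a b))))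
  have hF't : ContinuousOn (F' t) (uIcc a b) :=
    hF'.comp (f := fun x => (t, x)) (by fun_prop) fun x hx => ⟨ht, hx⟩
  refine (intervalIntegral.hasDerivAt_integral_of_dominated_loc_of_deriv_le
    (bound := fun _ => C) (Metric.closedBall_mem_nhds t hε) ?_ (hF t ht).intervalIntegrable
    ?_ ?_ intervalIntegrable_const ?_).2
  · filter_upwards [hU.mem_nhds ht] with s hs
    exact ((hF s hs).mono uIoc_subset_uIcc).aestronglyMeasurable measurableSet_uIoc
  · exact (hF't.mono uIoc_subset_uIcc).aestronglyMeasurable measurableSet_uIoc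
  · exact Filter.Eventually.of_forall fun x hx s hs => hC (s, x) ⟨hs, uIoc_subset_uIcc hx⟩
  · exact Filter.Eventually.of_forall fun x hx s hs => hd s (hεU hs) x (uIoc_subset_uIcc hx)

/-- A sliding average of a function with values in `[0, M]` has values in `[0, M]`. -/
theorem sliding_average_mem_Icc {f : ℝ → ℝ} (hf : Continuous f) {M η : ℝ} (hη : 0 < η)
    (hfM : ∀ y, f y ∈ Icc 0 M) (x : ℝ) :
    (1 / η) * (∫ y in x..(x + η), f y) ∈ Icc 0 M := by
  have hle : x ≤ x + η := by linarith
  have h0 : 0 ≤ ∫ y in x..(x + η), f y :=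
    intervalIntegral.integral_nonneg hle fun y _ => (hfM y).1
  have h1 : ∫ y in x..(x + η), f y ≤ ∫ _ in x..(x + η), M :=
    intervalIntegral.integral_mono_on hle (hf.intervalIntegrable _ _) intervalIntegrable_const
      fun y _ => (hfM y).2
  rw [intervalIntegral.integral_const, add_sub_cancel_left, smul_eq_mul] at h1
  refine ⟨by positivity, ?_⟩
  rw [one_div, inv_mul_le_iff₀ hη]
  exact h1

theorem hasDerivAt_sliding_average {f : ℝ → ℝ} (hf : Continuous f) (η x : ℝ) :
    HasDerivAt (fun z => (1 / η) * ∫ y in z..(z + η), f y) ((1 / η) * (f (x + η) - f x)) x := by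
  have hprim : ∀ z, HasDerivAt (fun u => ∫ y in (0 : ℝ)..u, f y) (f z) z := fun z =>
    intervalIntegral.integral_hasDerivAt_right (hf.intervalIntegrable _ _)
      (hf.stronglyMeasurableAtFilter _ _) hf.continuousAt
  have heq : (fun z => ∫ y in z..(z + η), f y)
      = fun z => (∫ y in (0 : ℝ)..(z + η), f y) - ∫ y in (0 : ℝ)..z, f y := by
    funext z
    exact (intervalIntegral.integral_interval_sub_left (hf.intervalIntegrable _ _)
      (hf.intervalIntegrable _ _)).symm
  refine HasDerivAt.const_mul (1 / η) ?_
  rw [heq]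
  exact ((hprim (x + η)).comp_add_const x η).sub (hprim x)

/-- For every `t > 0`, the derivative of the Lyapunov function
satisfies `d/dt L(t) = 2 ∫_{β(t)−η}^{β(t)} (v'(R(t,x))/η) ρ(t,x) (V(t,x) − v̄)² dx`. -/
theorem lyapunov_deriv_closed_form
    (η ρmax : ℝ) (hη : 0 < η) (hρmax : 0 < ρmax)
    (v : ℝ → ℝ) (hv : ContDiffOn ℝ 2 v (Set.Icc 0 ρmax))
    (hv' : ∀ r ∈ Set.Icc (0 : ℝ) ρmax, deriv v r < 0)
    (ρbar : ℝ) (hρbar : ρbar ∈ Set.Ioc 0 ρmax)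
    (vbar b : ℝ) (hvbar : vbar = v ρbar)
    (β : ℝ → ℝ) (hβ : ∀ t, β t = b + vbar * t)
    (ρ : ℝ → ℝ → ℝ)
    (hρreg : ContDiffOn ℝ 1 (fun p : ℝ × ℝ => ρ p.1 p.2) (Set.Ici 0 ×ˢ Set.univ))
    (hρrange : ∀ t ≥ (0 : ℝ), ∀ x, ρ t x ∈ Set.Icc 0 ρmax)
    (hρeq : ∀ t ≥ (0 : ℝ), ∀ x, β t ≤ x → ρ t x = ρbar)
    (V : ℝ → ℝ → ℝ)
    (hV : ∀ t x, V t x = v ((1 / η) * ∫ y in x..(x + η), ρ t y))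
    (hpde : ∀ t ≥ (0 : ℝ), ∀ x,
      derivWithin (fun s => ρ s x) (Set.Ici 0) t
        + deriv (fun y => ρ t y * V t y) x = 0)
    (R : ℝ → ℝ → ℝ)
    (hR : ∀ t x, R t x = (1 / η) * ((∫ y in x..(β t), ρ t y) + (x + η - β t) * ρbar))
    (L : ℝ → ℝ)
    (hL : ∀ t, L t = ∫ x in (β t - η)..(β t), (V t x - vbar) ^ 2) :
    ∀ t > (0 : ℝ),
      HasDerivAt L
        (2 * ∫ x in (β t - η)..(β t),
            (deriv v (R t x) / η) * ρ t x * (V t x - vbar) ^ 2) t := by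
  intro t ht
  have hρcont : ∀ s ≥ (0 : ℝ), Continuous (ρ s) := fun s hs =>
    continuousOn_univ.1 <| hρreg.continuousOn.comp (f := fun x : ℝ => (s, x)) (by fun_prop)
      fun x _ => ⟨hs, mem_univ x⟩
  have hopen : IsOpen (Ioi (0 : ℝ) ×ˢ (univ : Set ℝ)) := isOpen_Ioi.prod isOpen_univ
  have hreg : ContDiffOn ℝ 1 (fun p : ℝ × ℝ => ρ p.1 p.2) (Ioi 0 ×ˢ univ) :=
    hρreg.mono (Set.prod_mono Ioi_subset_Ici_self Subset.rfl)
  set D : ℝ × ℝ → ℝ × ℝ →L[ℝ] ℝ := fderiv ℝ (fun p : ℝ × ℝ => ρ p.1 p.2) with hD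
  have hDcont : ContinuousOn D (Ioi 0 ×ˢ univ) := hreg.continuousOn_fderiv_of_isOpen hopen le_rfl
  have hρD : ∀ s > (0 : ℝ), ∀ x,
      HasFDerivAt (fun p : ℝ × ℝ => ρ p.1 p.2) (D (s, x)) (s, x) := fun s hs x =>
    ((hreg.differentiableOn one_ne_zero).differentiableAt
      (hopen.mem_nhds (mk_mem_prod (mem_Ioi.2 hs) (mem_univ x)))).hasFDerivAt
  have hρt : ∀ s > (0 : ℝ), ∀ x, HasDerivAt (fun r => ρ r x) (D (s, x) (1, 0)) s :=
    fun s hs x => (hρD s hs x).comp_hasDerivAt (f := fun r => (r, x)) s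
      ((hasDerivAt_id s).prodMk (hasDerivAt_const s x))
  have hρx : ∀ s > (0 : ℝ), ∀ x, HasDerivAt (ρ s) (D (s, x) (0, 1)) x :=
    fun s hs x => (hρD s hs x).comp_hasDerivAt (f := fun y => (s, y)) x
      ((hasDerivAt_const x s).prodMk (hasDerivAt_id x))
  have hβd : ∀ s, HasDerivAt β vbar s := fun s => by
    rw [funext hβ]
    simpa using ((hasDerivAt_id s).const_mul vbar).const_add b
  have hβcont : Continuous β := continuous_iff_continuousAt.2 fun s => (hβd s).continuousAt
  have hshift : ∀ s > (0 : ℝ), ∀ y,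
      HasDerivAt (fun r => ρ r (β r + y)) (D (s, β s + y) (1, vbar)) s := fun s hs y =>
    (hρD s hs (β s + y)).comp_hasDerivAt (f := fun r => (r, β r + y)) s
      ((hasDerivAt_id s).prodMk ((hβd s).add_const y))
  have hDsplit : ∀ p, D p (1, vbar) = D p (1, 0) + vbar * D p (0, 1) := fun p => by
    rw [← smul_eq_mul, ← map_smul, ← map_add]
    simp
  -- the nonlocal average and its values
  set m : ℝ → ℝ → ℝ := fun s x => (1 / η) * ∫ y in x..(x + η), ρ s y with hm
  have hVm : ∀ s x, V s x = v (m s x) := hV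
  have hmem : ∀ s ≥ (0 : ℝ), ∀ x, m s x ∈ Icc 0 ρmax := fun s hs x =>
    sliding_average_mem_Icc (hρcont s hs) hη (hρrange s hs) x
  have hmx : ∀ s ≥ (0 : ℝ), ∀ x,
      HasDerivAt (m s) ((1 / η) * (ρ s (x + η) - ρ s x)) x := fun s hs x =>
    hasDerivAt_sliding_average (hρcont s hs) η x
  have hmcont : ∀ s ≥ (0 : ℝ), Continuous (m s) := fun s hs =>
    continuous_iff_continuousAt.2 fun x => (hmx s hs x).continuousAt
  have hvd : ∀ r ∈ Icc 0 ρmax, HasDerivAt v (deriv v r) r := fun r hr =>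
    (differentiableAt_of_deriv_ne_zero (hv' r hr).ne).hasDerivAt
  have hv'cont : ContinuousOn (deriv v) (Icc 0 ρmax) :=
    (hv.continuousOn_derivWithin (uniqueDiffOn_Icc hρmax) (by norm_num)).congr fun r hr =>
      ((hvd r hr).hasDerivWithinAt.derivWithin (uniqueDiffOn_Icc hρmax r hr)).symm
  have hVdiff : ∀ s ≥ (0 : ℝ), ∀ x, DifferentiableAt ℝ (V s) x := fun s hs x => by
    rw [funext (hVm s)]
    exact ((hvd _ (hmem s hs x)).comp x (hmx s hs x)).differentiableAt
  have hVbar : ∀ s ≥ (0 : ℝ), V s (β s) = vbar := fun s hs => by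
    have hconst : ∫ y in (β s)..(β s + η), ρ s y = ∫ _ in (β s)..(β s + η), ρbar :=
      intervalIntegral.integral_congr fun y hy => by
        rw [uIcc_of_le (by linarith)] at hy
        exact hρeq s hs y hy.1
    rw [hV, hconst, hvbar, intervalIntegral.integral_const, smul_eq_mul]
    congr 1
    field_simp
    ring
  -- the conservation law in the frame moving with `β`
  have hflux : ∀ s > (0 : ℝ), ∀ y, HasDerivAt
      (fun z => -(ρ s (β s + z) * (V s (β s + z) - vbar))) (D (s, β s + y) (1, vbar)) y := by
    intro s hs y
    have hlaw := hpde s hs.le (β s + y)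
    rw [((hρt s hs (β s + y)).hasDerivWithinAt.derivWithin
      (uniqueDiffOn_Ici 0 s hs.le))] at hlaw
    have hprod := ((hρx s hs (β s + y)).differentiableAt.mul
      (hVdiff s hs.le (β s + y))).hasDerivAt
    have h := ((hρx s hs (β s + y)).const_mul vbar).sub hprod
    have hlaw' : deriv (ρ s * V s) (β s + y) = - D (s, β s + y) (1, 0) := by
      have : deriv (ρ s * V s) (β s + y) = deriv (fun y => ρ s y * V s y) (β s + y) := rfl
      linarith
    rw [hlaw'] at h
    have h' := h.comp_const_add (β s) y
    refine (h'.congr_deriv ?_).congr_of_eventuallyEq (Filter.Eventually.of_forall fun z => ?_)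
    · rw [hDsplit]
      ring
    · simp only [Pi.mul_apply, Pi.sub_apply]
      ring
  have hsplit : ∀ s ≥ (0 : ℝ), ∀ x ∈ Icc (-η) 0,
      ∫ y in (β s + x)..(β s + x + η), ρ s y
        = (∫ y in (β s + x)..(β s), ρ s y) + (x + η) * ρbar := by
    intro s hs x hx
    rw [← intervalIntegral.integral_add_adjacent_intervals
      ((hρcont s hs).intervalIntegrable (β s + x) (β s)) ((hρcont s hs).intervalIntegrable _ _)]
    have hconst : ∫ y in (β s)..(β s + x + η), ρ s y = ∫ _ in (β s)..(β s + x + η), ρbar :=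
      intervalIntegral.integral_congr fun y hy => by
        rw [uIcc_of_le (by linarith [hx.1])] at hy
        exact hρeq s hs y hy.1
    rw [hconst, intervalIntegral.integral_const, smul_eq_mul]
    ring
  have hmR : ∀ s ≥ (0 : ℝ), ∀ x ∈ Icc (-η) 0, m s (β s + x) = R s (β s + x) := by
    intro s hs x hx
    simp only [hm, hR, hsplit s hs x hx]
    ring
  have hmt : ∀ s > (0 : ℝ), ∀ x ∈ Icc (-η) 0, HasDerivAt (fun r => m r (β r + x))
      ((1 / η) * (ρ s (β s + x) * (V s (β s + x) - vbar))) s := by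
    intro s hs x hx
    have hjoint : ContinuousOn (fun p : ℝ × ℝ => D (p.1, β p.1 + p.2) (1, vbar))
        (Ioi 0 ×ˢ uIcc x 0) :=
      (hDcont.comp (f := fun p : ℝ × ℝ => (p.1, β p.1 + p.2)) (by fun_prop)
        fun p hp => ⟨hp.1, mem_univ _⟩).clm_apply continuousOn_const
    have hint : ∫ y in x..0, D (s, β s + y) (1, vbar)
        = ρ s (β s + x) * (V s (β s + x) - vbar) := by
      rw [intervalIntegral.integral_eq_sub_of_hasDerivAt fun y _ => hflux s hs y]
      · simp [hVbar s hs.le]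
      · exact (hjoint.comp (f := fun y => (s, y)) (by fun_prop)
          fun y hy => ⟨hs, hy⟩).intervalIntegrable
    have hder := hasDerivAt_intervalIntegral_of_continuousOn (F := fun r y => ρ r (β r + y))
      (F' := fun r y => D (r, β r + y) (1, vbar)) isOpen_Ioi hs
      (fun r hr => ((hρcont r (le_of_lt hr)).comp (continuous_const_add (β r))).continuousOn)
      hjoint (fun r hr y _ => hshift r hr y)
    rw [hint] at hder
    refine ((hder.add_const ((x + η) * ρbar)).const_mul (1 / η)).congr_of_eventuallyEq ?_
    filter_upwards [Ioi_mem_nhds hs] with r hr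
    simp only [hm, hsplit r (le_of_lt hr) x hx, intervalIntegral.integral_comp_add_left (ρ r),
      add_zero]
  have hLshift : L = fun s => ∫ x in (-η)..0, (V s (β s + x) - vbar) ^ 2 := by
    funext s
    rw [hL, intervalIntegral.integral_comp_add_left (fun x => (V s x - vbar) ^ 2), add_zero,
      sub_eq_add_neg]
  let h : ℝ × ℝ → ℝ := fun q =>
    2 * (deriv v q.1 / η * q.2 * (v q.1 - vbar) ^ 2)
  have hh : ContinuousOn h (Icc 0 ρmax ×ˢ Icc 0 ρmax) := by
    have h1 : ContinuousOn (fun q : ℝ × ℝ => deriv v q.1) (Icc 0 ρmax ×ˢ Icc 0 ρmax) :=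
      hv'cont.comp continuousOn_fst fun q hq => hq.1
    have h2 : ContinuousOn (fun q : ℝ × ℝ => v q.1) (Icc 0 ρmax ×ˢ Icc 0 ρmax) :=
      hv.continuousOn.comp continuousOn_fst fun q hq => hq.1
    exact continuousOn_const.mul (((h1.div_const η).mul continuousOn_snd).mul
      ((h2.sub continuousOn_const).pow 2))
  obtain ⟨C, hC⟩ := (isCompact_Icc.prod isCompact_Icc).exists_bound_of_continuousOn hh
  have hmemh : ∀ s > (0 : ℝ), ∀ x,
      (m s (β s + x), ρ s (β s + x)) ∈ Icc 0 ρmax ×ˢ Icc 0 ρmax := fun s hs x =>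
    ⟨hmem s hs.le _, hρrange s hs.le _⟩
  have hIcc : uIcc (-η) 0 = Icc (-η) 0 := uIcc_of_le (by linarith)
  have hFcont : ∀ s > (0 : ℝ), Continuous fun x => (V s (β s + x) - vbar) ^ 2 := fun s hs => by
    have : Continuous (V s) := continuous_iff_continuousAt.2 fun x => (hVdiff s hs.le x).continuousAt
    fun_prop
  have hF'cont : Continuous fun x => h (m t (β t + x), ρ t (β t + x)) := by
    have h1 := hmcont t ht.le
    have h2 := hρcont t ht.le
    exact hh.comp_continuous (by fun_prop) (hmemh t ht)
  have hmain := (intervalIntegral.hasDerivAt_integral_of_dominated_loc_of_deriv_le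
    (μ := volume) (a := -η) (b := 0) (F := fun s x => (V s (β s + x) - vbar) ^ 2)
    (F' := fun s x => h (m s (β s + x), ρ s (β s + x))) (bound := fun _ => C)
    (Ioi_mem_nhds ht)
    (Filter.eventually_of_mem (Ioi_mem_nhds ht) fun s hs => (hFcont s hs).aestronglyMeasurable)
    ((hFcont t ht).intervalIntegrable _ _) hF'cont.aestronglyMeasurable
    (Filter.Eventually.of_forall fun x _ s hs => hC _ (hmemh s hs x))
    intervalIntegrable_const
    (Filter.Eventually.of_forall fun x hx s hs => by
      have hd := (((hvd _ (hmem s (le_of_lt hs) (β s + x))).comp s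
        (hmt s hs x (hIcc ▸ uIoc_subset_uIcc hx))).sub_const vbar).pow 2
      refine (hd.congr_deriv ?_).congr_of_eventuallyEq
        (Filter.Eventually.of_forall fun r => by simp [hVm])
      simp only [h, hVm, Function.comp_apply]
      ring)).2
  rw [hLshift]
  refine hmain.congr_deriv (Eq.symm ?_)
  have hstart : β t - η = β t + -η := sub_eq_add_neg _ _
  have hback := intervalIntegral.integral_comp_add_left (a := -η) (b := 0)
    (fun x => deriv v (R t x) / η * ρ t x * (V t x - vbar) ^ 2) (β t)
  rw [add_zero, ← hstart] at hback
  rw [← hback, ← intervalIntegral.integral_const_mul]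
  refine intervalIntegral.integral_congr fun x hx => ?_
  simp only [h, hVm, hmR t ht.le x (hIcc ▸ hx)]
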